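/- arXiv:2308.10607 — 4 statements merged into one kernel-verified Lean document; each statement's English description precedes it below -/
import Mathlib

section
/- For every q ∈ [0,1], the map Φ_q(ρ) = (1−q)ρ + (q/(d_A d_B)) Σ_{μ=0}^{d_A−1} Σ_{ν=0}^{d_B−1} T(μ,ν) ρ T(μ,ν)† is trace preserving, maps positive semidefinite operators to positive semidefinite operators, and maps separable density matrices to separable density matrices (i.e., Φ_q is a non-entangling quantum channel). -/
open Matrix Complex Finset
open scoped Kronecker ComplexOrder

noncomputable section

/-- The primitive `d`-th root of unity `ω = exp(2πi/d)`. -/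
def omg (d : ℕ) : ℂ := Complex.exp (2 * Real.pi * Complex.I / d)

/-- The shift operator `X|i⟩ = |i ⊕ 1⟩` (addition mod `d`). -/
def shiftX (d : ℕ) : Matrix (Fin d) (Fin d) ℂ :=
  Matrix.of fun i j => if (i : ℕ) = ((j : ℕ) + 1) % d then 1 else 0

/-- The clock operator `Z|i⟩ = ω^i |i⟩`. -/
def clockZ (d : ℕ) : Matrix (Fin d) (Fin d) ℂ :=
  Matrix.diagonal fun i => omg d ^ (i : ℕ)

/-- The modified clock operator on `ℂ^{dA}`, `Ẑ|i⟩ = ω_B^i |i⟩`. -/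
def clockZmod (dA dB : ℕ) : Matrix (Fin dA) (Fin dA) ℂ :=
  Matrix.diagonal fun i => omg dB ^ (i : ℕ)

/-- The generalized Bell state `|φ^{00}⟩ = (1/√dA) ∑ᵢ |i⟩⊗|i⟩`. -/
def bell00 (dA dB : ℕ) : Fin dA × Fin dB → ℂ :=
  fun p => if (p.2 : ℕ) = (p.1 : ℕ) then ((1 / Real.sqrt dA : ℝ) : ℂ) else 0

/-- The generalized Bell state `|φ^{αβ}⟩ = (Z_A^α ⊗ X_B^β)|φ^{00}⟩`. -/
def bell (dA dB : ℕ) (α β : ℕ) : Fin dA × Fin dB → ℂ :=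
  Matrix.mulVec ((clockZ dA ^ α) ⊗ₖ (shiftX dB ^ β)) (bell00 dA dB)

/-- The outer product `|v⟩⟨v|`. -/
def outer {n : Type*} [Fintype n] (v : n → ℂ) : Matrix n n ℂ :=
  Matrix.of fun i j => v i * (starRingEnd ℂ) (v j)

/-- The Bell diagonal state `ρ_P = ∑_{αβ} p_{αβ} |φ^{αβ}⟩⟨φ^{αβ}|`. -/
def rhoBDS (dA dB : ℕ) (p : Fin dA → Fin dB → ℝ) :
    Matrix (Fin dA × Fin dB) (Fin dA × Fin dB) ℂ :=
  ∑ α : Fin dA, ∑ β : Fin dB, (p α β : ℂ) • outer (bell dA dB (α : ℕ) (β : ℕ))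

/-- The Fourier coefficients `λ_{μν} = ∑_{αβ} p_{αβ} ω_A^{αμ} ω_B^{βν}`. -/
def lam (dA dB : ℕ) (p : Fin dA → Fin dB → ℝ) (μ ν : ℕ) : ℂ :=
  ∑ α : Fin dA, ∑ β : Fin dB,
    (p α β : ℂ) * omg dA ^ ((α : ℕ) * μ) * omg dB ^ ((β : ℕ) * ν)

/-- The partial transpose on subsystem `A`: `⟨ij|ρ^{T_A}|kl⟩ = ⟨kj|ρ|il⟩`. -/
def ptA {dA dB : ℕ} (ρ : Matrix (Fin dA × Fin dB) (Fin dA × Fin dB) ℂ) :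
    Matrix (Fin dA × Fin dB) (Fin dA × Fin dB) ℂ :=
  Matrix.of fun p q => ρ (q.1, p.2) (p.1, q.2)

/-- A bipartite density matrix is separable if it is a finite convex combination of
tensor products of density matrices. -/
def IsSepState {dA dB : ℕ} (σ : Matrix (Fin dA × Fin dB) (Fin dA × Fin dB) ℂ) : Prop :=
  ∃ (n : ℕ) (q : Fin n → ℝ) (a : Fin n → Matrix (Fin dA) (Fin dA) ℂ)
    (b : Fin n → Matrix (Fin dB) (Fin dB) ℂ),
    (∀ i, 0 ≤ q i) ∧ (∑ i, q i = 1) ∧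
    (∀ i, (a i).PosSemidef ∧ (a i).trace = 1) ∧
    (∀ i, (b i).PosSemidef ∧ (b i).trace = 1) ∧
    σ = ∑ i, (q i : ℂ) • (a i ⊗ₖ b i)

/-- The local unitaries `T(μ,ν) = X_A^μ Ẑ^ν ⊗ X_B^μ Z_B^{-ν}`. -/
def Tgate (dA dB : ℕ) (μ ν : ℕ) : Matrix (Fin dA × Fin dB) (Fin dA × Fin dB) ℂ :=
  (shiftX dA ^ μ * clockZmod dA dB ^ ν) ⊗ₖ (shiftX dB ^ μ * (clockZ dB ^ ν)ᴴ)

/-- The map `Φ_q(ρ) = (1-q)ρ + (q/(dA dB)) ∑_{μν} T(μ,ν) ρ T(μ,ν)†`. -/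
def Phi (dA dB : ℕ) (q : ℝ) (ρ : Matrix (Fin dA × Fin dB) (Fin dA × Fin dB) ℂ) :
    Matrix (Fin dA × Fin dB) (Fin dA × Fin dB) ℂ :=
  (1 - (q : ℂ)) • ρ + ((q : ℂ) / (dA * dB)) •
    ∑ μ : Fin dA, ∑ ν : Fin dB, Tgate dA dB (μ : ℕ) (ν : ℕ) * ρ * (Tgate dA dB (μ : ℕ) (ν : ℕ))ᴴ


theorem shiftX_mem_unitary (d : ℕ) : shiftX d ∈ unitary (Matrix (Fin d) (Fin d) ℂ) := by
  refine mem_unitaryGroup_iff'.2 ?_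
  ext i j
  have hd : 0 < d := i.pos
  let s : Fin d := ⟨((i : ℕ) + 1) % d, Nat.mod_lt _ hd⟩
  rw [star_eq_conjTranspose, mul_apply, Finset.sum_eq_single s]
  · have hij : ((i : ℕ) + 1) % d = ((j : ℕ) + 1) % d ↔ i = j := by
      constructor
      · intro h
        have h' : (i : ℕ) ≡ j [MOD d] := Nat.ModEq.add_right_cancel' 1 h
        exact Fin.ext (h'.eq_of_lt_of_lt i.isLt j.isLt)
      · rintro rfl
        rfl
    simp [shiftX, s, hij, one_apply]
  · intro k _ hk
    have hk' : (k : ℕ) ≠ ((i : ℕ) + 1) % d := fun h => hk (Fin.ext h)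
    simp [shiftX, hk']
  · simp

theorem star_omg_mul_omg (d : ℕ) : star (omg d) * omg d = 1 := by
  have h : ‖omg d‖ = 1 := by
    have : (2 * Real.pi * Complex.I / d : ℂ) = ((2 * Real.pi / d : ℝ) : ℂ) * Complex.I := by
      push_cast
      ring
    rw [omg, this, Complex.norm_exp_ofReal_mul_I]
  simpa [h] using Complex.conj_mul' (omg d)

theorem clockZmod_mem_unitary (dA dB : ℕ) :
    clockZmod dA dB ∈ unitary (Matrix (Fin dA) (Fin dA) ℂ) := by
  refine mem_unitaryGroup_iff'.2 ?_
  rw [clockZmod, star_eq_conjTranspose, diagonal_conjTranspose, diagonal_mul_diagonal,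
    ← diagonal_one]
  congr 1
  funext i
  rw [Pi.star_apply, star_pow, ← mul_pow, star_omg_mul_omg, one_pow]

theorem clockZ_mem_unitary (d : ℕ) : clockZ d ∈ unitary (Matrix (Fin d) (Fin d) ℂ) :=
  clockZmod_mem_unitary d d

/-- A convex combination of product states over any finite index type is separable. -/
theorem isSepState_of_fintype {dA dB : ℕ} {ι : Type*} [Fintype ι] (q : ι → ℝ)
    (a : ι → Matrix (Fin dA) (Fin dA) ℂ) (b : ι → Matrix (Fin dB) (Fin dB) ℂ)
    (hq : ∀ i, 0 ≤ q i) (hsum : ∑ i, q i = 1)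
    (ha : ∀ i, (a i).PosSemidef ∧ (a i).trace = 1)
    (hb : ∀ i, (b i).PosSemidef ∧ (b i).trace = 1) :
    IsSepState (∑ i, (q i : ℂ) • (a i ⊗ₖ b i)) := by
  let e := (Fintype.equivFin ι).symm
  refine ⟨Fintype.card ι, q ∘ e, a ∘ e, b ∘ e, fun i => hq _, ?_, fun i => ha _,
    fun i => hb _, ?_⟩
  · rw [← hsum]
    exact e.sum_comp q
  · exact (e.sum_comp fun i => (q i : ℂ) • (a i ⊗ₖ b i)).symm

theorem trace_unitary_conj {n : Type*} [Fintype n] [DecidableEq n] {U : Matrix n n ℂ}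
    (hU : U ∈ unitary (Matrix n n ℂ)) (ρ : Matrix n n ℂ) : (U * ρ * Uᴴ).trace = ρ.trace := by
  rw [trace_mul_cycle, ← star_eq_conjTranspose, Unitary.star_mul_self_of_mem hU, one_mul]

/-- A convex combination of local unitary conjugations preserves separability. -/
theorem IsSepState.sum_local_unitary_conj {dA dB : ℕ} {κ : Type*} [Fintype κ] (p : κ → ℝ)
    (A : κ → Matrix (Fin dA) (Fin dA) ℂ) (B : κ → Matrix (Fin dB) (Fin dB) ℂ)
    (hp : ∀ k, 0 ≤ p k) (hsum : ∑ k, p k = 1)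
    (hA : ∀ k, A k ∈ unitary (Matrix (Fin dA) (Fin dA) ℂ))
    (hB : ∀ k, B k ∈ unitary (Matrix (Fin dB) (Fin dB) ℂ))
    {σ : Matrix (Fin dA × Fin dB) (Fin dA × Fin dB) ℂ} (hσ : IsSepState σ) :
    IsSepState (∑ k, (p k : ℂ) • (A k ⊗ₖ B k * σ * (A k ⊗ₖ B k)ᴴ)) := by
  obtain ⟨n, q, a, b, hq, hq1, ha, hb, rfl⟩ := hσ
  have key := isSepState_of_fintype (ι := κ × Fin n) (fun x => p x.1 * q x.2)
    (fun x => A x.1 * a x.2 * (A x.1)ᴴ) (fun x => B x.1 * b x.2 * (B x.1)ᴴ)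
    (fun x => mul_nonneg (hp _) (hq _))
    (by rw [Fintype.sum_prod_type, ← Fintype.sum_mul_sum, hsum, hq1, one_mul])
    (fun x => ⟨(ha _).1.mul_mul_conjTranspose_same _,
      (trace_unitary_conj (hA _) _).trans (ha _).2⟩)
    (fun x => ⟨(hb _).1.mul_mul_conjTranspose_same _,
      (trace_unitary_conj (hB _) _).trans (hb _).2⟩)
  convert key using 1
  rw [Fintype.sum_prod_type]
  refine Finset.sum_congr rfl fun k _ => ?_
  rw [Finset.mul_sum, Finset.sum_mul, Finset.smul_sum]
  refine Finset.sum_congr rfl fun i _ => ?_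
  rw [mul_smul_comm, smul_mul_assoc, smul_smul, conjTranspose_kronecker, ← mul_kronecker_mul,
    ← mul_kronecker_mul, Complex.ofReal_mul]

/-- The weights of `Φ_q` as a mixture of the identity (`none`) and the gates `T(μ,ν)`. -/
def phiWeight (dA dB : ℕ) (q : ℝ) : Option (Fin dA × Fin dB) → ℝ
  | none => 1 - q
  | some _ => q / (dA * dB)

/-- The unitaries on subsystem `A` appearing in `Φ_q`. -/
def phiLocalA (dA dB : ℕ) : Option (Fin dA × Fin dB) → Matrix (Fin dA) (Fin dA) ℂ
  | none => 1
  | some x => shiftX dA ^ (x.1 : ℕ) * clockZmod dA dB ^ (x.2 : ℕ)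

/-- The unitaries on subsystem `B` appearing in `Φ_q`. -/
def phiLocalB (dA dB : ℕ) : Option (Fin dA × Fin dB) → Matrix (Fin dB) (Fin dB) ℂ
  | none => 1
  | some x => shiftX dB ^ (x.1 : ℕ) * (clockZ dB ^ (x.2 : ℕ))ᴴ

theorem phiLocalA_mem_unitary (dA dB : ℕ) (k : Option (Fin dA × Fin dB)) :
    phiLocalA dA dB k ∈ unitary (Matrix (Fin dA) (Fin dA) ℂ) := by
  cases k with
  | none => exact one_mem _
  | some x =>
    exact mul_mem (pow_mem (shiftX_mem_unitary _) _) (pow_mem (clockZmod_mem_unitary _ _) _)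

theorem phiLocalB_mem_unitary (dA dB : ℕ) (k : Option (Fin dA × Fin dB)) :
    phiLocalB dA dB k ∈ unitary (Matrix (Fin dB) (Fin dB) ℂ) := by
  cases k with
  | none => exact one_mem _
  | some x =>
    exact mul_mem (pow_mem (shiftX_mem_unitary _) _)
      (Unitary.star_mem (pow_mem (clockZ_mem_unitary _) _))

theorem phiWeight_nonneg (dA dB : ℕ) {q : ℝ} (hq0 : 0 ≤ q) (hq1 : q ≤ 1)
    (k : Option (Fin dA × Fin dB)) : 0 ≤ phiWeight dA dB q k := by
  cases k with
  | none => exact sub_nonneg.2 hq1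
  | some x => exact div_nonneg hq0 (by positivity)

theorem sum_phiWeight {dA dB : ℕ} (hA : dA ≠ 0) (hB : dB ≠ 0) (q : ℝ) :
    ∑ k, phiWeight dA dB q k = 1 := by
  simp only [Fintype.sum_option, phiWeight, Finset.sum_const, Finset.card_univ,
    Fintype.card_prod, Fintype.card_fin, nsmul_eq_mul, Nat.cast_mul]
  field_simp
  ring

theorem Phi_eq_sum (dA dB : ℕ) (q : ℝ) (ρ : Matrix (Fin dA × Fin dB) (Fin dA × Fin dB) ℂ) :
    Phi dA dB q ρ = ∑ k, (phiWeight dA dB q k : ℂ) •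
      (phiLocalA dA dB k ⊗ₖ phiLocalB dA dB k * ρ *
        (phiLocalA dA dB k ⊗ₖ phiLocalB dA dB k)ᴴ) := by
  simp [Phi, Tgate, Fintype.sum_option, Fintype.sum_prod_type, phiWeight, phiLocalA, phiLocalB,
    Finset.smul_sum, -Complex.coe_smul]

/-- `Φ_q` is a non-entangling quantum channel: it is trace preserving,
positivity preserving, and maps separable density matrices to separable ones. -/
theorem phi_q_nonentangling_channel (dA dB : ℕ) (hd : dA ≤ dB)
    (q : ℝ) (hq0 : 0 ≤ q) (hq1 : q ≤ 1) :
    (∀ ρ : Matrix (Fin dA × Fin dB) (Fin dA × Fin dB) ℂ,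
      (Phi dA dB q ρ).trace = ρ.trace) ∧
    (∀ ρ : Matrix (Fin dA × Fin dB) (Fin dA × Fin dB) ℂ,
      ρ.PosSemidef → (Phi dA dB q ρ).PosSemidef) ∧
    (∀ σ : Matrix (Fin dA × Fin dB) (Fin dA × Fin dB) ℂ,
      IsSepState σ → IsSepState (Phi dA dB q σ)) := by
  refine ⟨fun ρ => ?_, fun ρ hρ => ?_, fun σ hσ => ?_⟩
  · rcases isEmpty_or_nonempty (Fin dA × Fin dB) with _ | ⟨i, j⟩
    · simp [Matrix.trace]
    · rw [Phi_eq_sum, trace_sum]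
      simp_rw [trace_smul, trace_unitary_conj (kronecker_mem_unitary
        (phiLocalA_mem_unitary dA dB _) (phiLocalB_mem_unitary dA dB _))]
      rw [← Finset.sum_smul, ← Complex.ofReal_sum, sum_phiWeight i.pos.ne' j.pos.ne',
        Complex.ofReal_one, one_smul]
  · rw [Phi_eq_sum]
    exact posSemidef_sum _ fun k _ => (hρ.mul_mul_conjTranspose_same _).smul
      (Complex.zero_le_real.2 (phiWeight_nonneg dA dB hq0 hq1 k))
  · have hne : dA ≠ 0 ∧ dB ≠ 0 := by
      obtain ⟨n, q', a, b, -, hsum, ha, hb, -⟩ := hσ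
      obtain ⟨i⟩ : Nonempty (Fin n) := by
        by_contra h
        rw [not_nonempty_iff] at h
        simp at hsum
      constructor
      · rintro rfl
        simpa [Matrix.trace] using (ha i).2
      · rintro rfl
        simpa [Matrix.trace] using (hb i).2
    rw [Phi_eq_sum]
    exact hσ.sum_local_unitary_conj _ _ _ (phiWeight_nonneg dA dB hq0 hq1)
      (sum_phiWeight hne.1 hne.2 q) (phiLocalA_mem_unitary dA dB) (phiLocalB_mem_unitary dA dB)

end
end

section
/- Let ρ_S be a dichotomous Bell diagonal state in equal local dimensions d. Then (ρ_S^{T_A})² is proportional to ρ_S^{T_A} (so that ρ_S^{T_A} is positive semidefinite) if and only if for every displacement Δ = (δ₁,δ₂) ∈ (Z_d × Z_d) \ {(0,0)} the phase sum vanishes: Σ ω^{αδ₂ − βδ₁} = 0, where the sum runs over all (α,β) ∈ S with (α,β)+Δ ∉ S (addition componentwise mod d). -/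
open Matrix Complex Finset
open scoped Kronecker ComplexOrder

noncomputable section

/-- The dichotomous Bell diagonal state associated to `S ⊆ Z_d × Z_d`. -/
def rhoDich (d : ℕ) [NeZero d] (S : Finset (ZMod d × ZMod d)) :
    Matrix (Fin d × Fin d) (Fin d × Fin d) ℂ :=
  (1 / (S.card : ℂ)) • ∑ s ∈ S, outer (bell d d s.1.val s.2.val)

theorem omg_zpow (d : ℕ) [NeZero d] (n : ℤ) :
    omg d ^ n = ZMod.stdAddChar (n : ZMod d) := by
  rw [ZMod.stdAddChar_coe, omg, ← Complex.exp_int_mul]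
  congr 1
  ring

theorem omg_pow (d : ℕ) [NeZero d] (n : ℕ) :
    omg d ^ n = ZMod.stdAddChar (n : ZMod d) := by
  simpa using omg_zpow d n

/-- The identification of `Fin d` with `ZMod d` by reduction mod `d`. -/
def finEquivZMod (d : ℕ) [NeZero d] : Fin d ≃ ZMod d where
  toFun i := ((i : ℕ) : ZMod d)
  invFun x := ⟨x.val, x.val_lt⟩
  left_inv i := by ext; simp [ZMod.val_natCast, Nat.mod_eq_of_lt i.2]
  right_inv x := by simp

theorem finEquivZMod_apply (d : ℕ) [NeZero d] (i : Fin d) :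
    finEquivZMod d i = ((i : ℕ) : ZMod d) := rfl

theorem clockZ_pow (d : ℕ) [NeZero d] (a : ZMod d) :
    clockZ d ^ a.val =
      Matrix.diagonal fun i => ZMod.stdAddChar (a * finEquivZMod d i) := by
  rw [clockZ, Matrix.diagonal_pow]
  congr 1
  ext i
  rw [Pi.pow_apply, ← pow_mul, omg_pow, finEquivZMod_apply]
  simp [mul_comm]

theorem shiftX_apply (d : ℕ) [NeZero d] (i j : Fin d) :
    shiftX d i j = if finEquivZMod d i = finEquivZMod d j + 1 then 1 else 0 := by
  rw [shiftX, Matrix.of_apply]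
  refine if_congr ?_ rfl rfl
  rw [finEquivZMod_apply, finEquivZMod_apply, ← Nat.cast_succ, ZMod.natCast_eq_natCast_iff,
    Nat.ModEq, Nat.mod_eq_of_lt i.2]

theorem shiftX_pow_apply (d : ℕ) [NeZero d] (n : ℕ) (i j : Fin d) :
    (shiftX d ^ n) i j = if finEquivZMod d i = finEquivZMod d j + n then 1 else 0 := by
  induction n generalizing j with
  | zero => simp [Matrix.one_apply]
  | succ n ih =>
    rw [pow_succ, Matrix.mul_apply]
    simp only [ih, shiftX_apply]
    rw [Fintype.sum_equiv (finEquivZMod d) _ (fun x =>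
      (if finEquivZMod d i = x + n then (1 : ℂ) else 0) *
        if x = finEquivZMod d j + 1 then 1 else 0) (fun _ => rfl)]
    simp [add_assoc, add_comm (1 : ZMod d)]

theorem bell_apply (d : ℕ) [NeZero d] (a b : ZMod d) (i j : Fin d) :
    bell d d a.val b.val (i, j) = if finEquivZMod d j = finEquivZMod d i + b then
      ZMod.stdAddChar (a * finEquivZMod d i) * ((1 / Real.sqrt d : ℝ) : ℂ) else 0 := by
  simp only [bell, Matrix.mulVec, dotProduct, Fintype.sum_prod_type, Matrix.kronecker_apply,
    clockZ_pow, shiftX_pow_apply, bell00, Fin.val_inj, Matrix.diagonal_apply]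
  rw [Finset.sum_eq_single i, Finset.sum_eq_single i]
  · by_cases h : finEquivZMod d j = finEquivZMod d i + b <;> simp [h]
  · intro k _ hk
    simp [hk]
  · simp
  · intro k _ hk
    simp [hk.symm]
  · simp

/-- The entries of the unnormalised partial transpose of the state of `S`. -/
def ptEntry {d : ℕ} [NeZero d] (S : Finset (ZMod d × ZMod d)) (i j k l : ZMod d) : ℂ :=
  ∑ s ∈ S, if j = k + s.2 ∧ l = i + s.2 then ZMod.stdAddChar (s.1 * (k - i)) else 0

theorem ptA_rhoDich_apply (d : ℕ) [NeZero d] (S : Finset (ZMod d × ZMod d))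
    (p q : Fin d × Fin d) :
    ptA (rhoDich d S) p q = (1 / (S.card * d : ℂ)) *
      ptEntry S (finEquivZMod d p.1) (finEquivZMod d p.2)
        (finEquivZMod d q.1) (finEquivZMod d q.2) := by
  have hd : ((1 / Real.sqrt d : ℝ) : ℂ) * ((1 / Real.sqrt d : ℝ) : ℂ) = 1 / d := by
    rw [← Complex.ofReal_mul, div_mul_div_comm, Real.mul_self_sqrt (Nat.cast_nonneg d)]
    simp
  rw [ptA, Matrix.of_apply, rhoDich, Matrix.smul_apply, Matrix.sum_apply, smul_eq_mul, ptEntry,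
    Finset.mul_sum, Finset.mul_sum]
  refine Finset.sum_congr rfl fun s _ => ?_
  rw [outer, Matrix.of_apply, bell_apply, bell_apply]
  by_cases h₁ : finEquivZMod d p.2 = finEquivZMod d q.1 + s.2
  · by_cases h₂ : finEquivZMod d q.2 = finEquivZMod d p.1 + s.2
    · rw [if_pos h₁, if_pos h₂, if_pos ⟨h₁, h₂⟩, map_mul (starRingEnd ℂ), Complex.conj_ofReal,
        ← AddChar.map_neg_eq_conj, mul_sub, sub_eq_add_neg, AddChar.map_add_eq_mul,
        one_div ((S.card : ℂ) * d), mul_inv]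
      linear_combination (S.card : ℂ)⁻¹ * ZMod.stdAddChar (s.1 * finEquivZMod d q.1) *
        ZMod.stdAddChar (-(s.1 * finEquivZMod d p.1)) * hd
    · simp [h₂]
  · simp [h₁]

/-- The phase `ω^{-(αδ₂ - βδ₁)}` attached to a point and a displacement. -/
def phase {d : ℕ} [NeZero d] (s Δ : ZMod d × ZMod d) : ℂ :=
  ZMod.stdAddChar (-(s.1 * Δ.2 - s.2 * Δ.1))

theorem sum_indicator_mul_indicator {d : ℕ} [NeZero d] (s s' : ZMod d × ZMod d)
    (i j k l : ZMod d) :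
    ∑ r, ∑ t, (if j = r + s.2 ∧ t = i + s.2 then (ZMod.stdAddChar (s.1 * (r - i)) : ℂ) else 0) *
      (if t = k + s'.2 ∧ l = r + s'.2 then ZMod.stdAddChar (s'.1 * (k - r)) else 0) =
    if i + s.2 = k + s'.2 ∧ l = j - s.2 + s'.2 then
      ZMod.stdAddChar (s.1 * (j - s.2 - i) + s'.1 * (k - (j - s.2))) else 0 := by
  rw [Finset.sum_eq_single (j - s.2), Finset.sum_eq_single (i + s.2)]
  · simp [AddChar.map_add_eq_mul]
  · intro t _ ht
    simp [ht]
  · simp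
  · intro r _ hr
    refine Finset.sum_eq_zero fun t _ => ?_
    rw [if_neg (fun h => hr (eq_sub_of_add_eq h.1.symm)), zero_mul]
  · simp

theorem sum_filter_phase_eq {d : ℕ} [NeZero d] (S : Finset (ZMod d × ZMod d))
    (Δ : ZMod d × ZMod d) :
    ∑ s ∈ S with s + Δ ∈ S, phase s Δ =
      ∑ s ∈ S, ∑ s' ∈ S, if s' = s + Δ then phase s Δ else 0 := by
  rw [Finset.sum_filter]
  exact Finset.sum_congr rfl fun s _ => (Finset.sum_ite_eq' S (s + Δ) fun _ => phase s Δ).symm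

theorem sum_ptEntry_mul_ptEntry {d : ℕ} [NeZero d] (S : Finset (ZMod d × ZMod d))
    (i j k l : ZMod d) :
    ∑ r, ∑ t, ptEntry S i j r t * ptEntry S r t k l = if i + j = k + l then
      ∑ δ, ZMod.stdAddChar (δ * (k - j)) *
        ∑ s ∈ S with s + (δ, i - k) ∈ S, phase s (δ, i - k) else 0 := by
  have hl : ∑ r, ∑ t, ptEntry S i j r t * ptEntry S r t k l = ∑ s ∈ S, ∑ s' ∈ S,
      if i + s.2 = k + s'.2 ∧ l = j - s.2 + s'.2 then
        ZMod.stdAddChar (s.1 * (j - s.2 - i) + s'.1 * (k - (j - s.2))) else 0 := by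
    simp only [ptEntry, Finset.sum_mul_sum, ← sum_indicator_mul_indicator]
    simp only [Finset.sum_comm (s := (Finset.univ : Finset (ZMod d))) (t := S)]
  have hr : ∑ δ, ZMod.stdAddChar (δ * (k - j)) *
        ∑ s ∈ S with s + (δ, i - k) ∈ S, phase s (δ, i - k) =
      ∑ s ∈ S, ∑ s' ∈ S, ∑ δ, ZMod.stdAddChar (δ * (k - j)) *
        if s' = s + (δ, i - k) then phase s (δ, i - k) else 0 := by
    simp only [sum_filter_phase_eq, Finset.mul_sum]
    simp only [Finset.sum_comm (s := (Finset.univ : Finset (ZMod d))) (t := S)]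
  rw [hl, hr]
  split_ifs with h
  · refine Finset.sum_congr rfl fun s _ => Finset.sum_congr rfl fun s' _ => ?_
    rw [Finset.sum_eq_single (s'.1 - s.1)]
    · by_cases hs : i + s.2 = k + s'.2
      · have hs' : s' = s + (s'.1 - s.1, i - k) := by
          ext
          · simp
          · simp only [Prod.snd_add]
            linear_combination -hs
        rw [if_pos ⟨hs, by linear_combination hs - h⟩, if_pos hs', phase,
          ← AddChar.map_add_eq_mul]
        congr 1
        ring
      · rw [if_neg (fun h => hs h.1), if_neg, mul_zero]
        intro hs'
        have := congrArg Prod.snd hs'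
        simp only [Prod.snd_add] at this
        exact hs (by linear_combination -this)
    · intro δ _ hδ
      rw [if_neg, mul_zero]
      rintro rfl
      simp at hδ
    · simp
  · refine Finset.sum_eq_zero fun s _ => Finset.sum_eq_zero fun s' _ => if_neg ?_
    rintro ⟨h₁, h₂⟩
    exact h (by linear_combination h₁ - h₂)

theorem card_mul_ptEntry {d : ℕ} [NeZero d] (S : Finset (ZMod d × ZMod d))
    (i j k l : ZMod d) :
    d * ptEntry S i j k l = if i + j = k + l then
      ∑ δ, ZMod.stdAddChar (δ * (k - j)) * ∑ s ∈ S, phase s (δ, i - k) else 0 := by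
  have hr : ∑ δ, ZMod.stdAddChar (δ * (k - j)) * ∑ s ∈ S, phase s (δ, i - k) =
      ∑ s ∈ S, ZMod.stdAddChar (s.1 * (k - i)) *
        ∑ δ, (ZMod.stdAddChar (δ * (k - j + s.2)) : ℂ) := by
    simp only [Finset.mul_sum]
    rw [Finset.sum_comm]
    refine Finset.sum_congr rfl fun s _ => Finset.sum_congr rfl fun δ _ => ?_
    rw [phase, ← AddChar.map_add_eq_mul, ← AddChar.map_add_eq_mul]
    congr 1
    ring
  rw [hr, ptEntry, Finset.mul_sum]
  split_ifs with h
  · refine Finset.sum_congr rfl fun s _ => ?_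
    rw [AddChar.sum_mulShift _ (ZMod.isPrimitive_stdAddChar d), ZMod.card]
    by_cases hj : k - j + s.2 = 0
    · rw [if_pos hj, if_pos ⟨by linear_combination -hj, by linear_combination -hj - h⟩, mul_comm]
    · rw [if_neg hj, if_neg (fun h => hj (by linear_combination -h.1))]
      simp
  · refine Finset.sum_eq_zero fun s _ => ?_
    rw [if_neg (fun h' => h (by linear_combination h'.1 - h'.2)), mul_zero]

theorem eq_of_sum_stdAddChar_eq {d : ℕ} [NeZero d] {f g : ZMod d → ℂ}
    (h : ∀ x, ∑ δ, ZMod.stdAddChar (-(δ * x)) * f δ = ∑ δ, ZMod.stdAddChar (-(δ * x)) * g δ) :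
    f = g := by
  apply ZMod.dft.injective
  ext x
  simpa [ZMod.dft_apply] using h x

theorem exists_ptEntry_sq_eq_iff {d : ℕ} [NeZero d] (S : Finset (ZMod d × ZMod d))
    (hS : S.Nonempty) :
    (∃ c : ℂ, ∀ i j k l, ∑ r, ∑ t, ptEntry S i j r t * ptEntry S r t k l =
      c * ptEntry S i j k l) ↔
    ∀ Δ, ∑ s ∈ S with s + Δ ∈ S, phase s Δ = ∑ s ∈ S, phase s Δ := by
  have hd : (d : ℂ) ≠ 0 := Nat.cast_ne_zero.mpr (NeZero.ne d)
  constructor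
  · rintro ⟨c, hc⟩
    have key : ∀ Δ : ZMod d × ZMod d,
        d * ∑ s ∈ S with s + Δ ∈ S, phase s Δ = c * ∑ s ∈ S, phase s Δ := by
      rintro ⟨δ, y⟩
      refine congrFun (eq_of_sum_stdAddChar_eq
        (f := fun δ => d * ∑ s ∈ S with s + (δ, y) ∈ S, phase s (δ, y))
        (g := fun δ => c * ∑ s ∈ S, phase s (δ, y)) fun x => ?_) δ
      have h := congrArg (fun z => (d : ℂ) * z) (hc y x 0 (y + x))
      simp only [mul_left_comm (d : ℂ) c, sum_ptEntry_mul_ptEntry, card_mul_ptEntry, zero_add,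
        if_true, sub_zero, zero_sub, mul_neg] at h
      simpa only [Finset.mul_sum, mul_left_comm] using h
    have hcd : c = d := by
      have h := key 0
      have hS' : (S.card : ℂ) ≠ 0 := Nat.cast_ne_zero.mpr hS.card_pos.ne'
      simp only [phase, add_zero, Finset.filter_mem_eq_inter, Finset.inter_self, Prod.fst_zero,
        Prod.snd_zero, mul_zero, sub_zero, neg_zero, AddChar.map_zero_eq_one, Finset.sum_const,
        nsmul_eq_mul, mul_one] at h
      exact (mul_right_cancel₀ hS' h).symm
    intro Δ
    have h := key Δ
    rw [hcd] at h
    exact mul_left_cancel₀ hd h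
  · intro h
    refine ⟨d, fun i j k l => ?_⟩
    rw [sum_ptEntry_mul_ptEntry, card_mul_ptEntry]
    simp only [h]

theorem sum_phase_eq_iff {d : ℕ} [NeZero d] (S : Finset (ZMod d × ZMod d))
    (Δ : ZMod d × ZMod d) :
    ∑ s ∈ S with s + Δ ∈ S, phase s Δ = ∑ s ∈ S, phase s Δ ↔
    ∑ s ∈ S with s + Δ ∉ S,
      omg d ^ (((s.1.val * Δ.2.val : ℕ) : ℤ) - ((s.2.val * Δ.1.val : ℕ) : ℤ)) = 0 := by
  rw [← Finset.sum_filter_add_sum_filter_not S (fun s => s + Δ ∈ S), left_eq_add,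
    ← map_eq_zero_iff (starRingEnd ℂ) (RingHom.injective _), map_sum]
  refine Eq.congr_left (Finset.sum_congr rfl fun s _ => ?_)
  rw [omg_zpow, phase, AddChar.map_neg_eq_conj, Complex.conj_conj]
  simp

theorem exists_ptA_sq_eq_iff (d : ℕ) [NeZero d] (S : Finset (ZMod d × ZMod d))
    (hS : S.Nonempty) :
    (∃ c : ℂ, ptA (rhoDich d S) * ptA (rhoDich d S) = c • ptA (rhoDich d S)) ↔
    ∃ c : ℂ, ∀ i j k l, ∑ r, ∑ t, ptEntry S i j r t * ptEntry S r t k l =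
      c * ptEntry S i j k l := by
  set c₀ : ℂ := 1 / (S.card * d : ℂ) with hc₀
  have hc : c₀ ≠ 0 := one_div_ne_zero (mul_ne_zero (Nat.cast_ne_zero.mpr hS.card_pos.ne')
    (Nat.cast_ne_zero.mpr (NeZero.ne d)))
  have hmul : ∀ p q, (ptA (rhoDich d S) * ptA (rhoDich d S)) p q = c₀ * c₀ *
      ∑ r, ∑ t, ptEntry S (finEquivZMod d p.1) (finEquivZMod d p.2) r t *
        ptEntry S r t (finEquivZMod d q.1) (finEquivZMod d q.2) := by
    intro p q
    rw [Matrix.mul_apply, Fintype.sum_prod_type, Finset.mul_sum]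
    refine Fintype.sum_equiv (finEquivZMod d) _ _ fun r => ?_
    rw [Finset.mul_sum]
    refine Fintype.sum_equiv (finEquivZMod d) _ _ fun t => ?_
    rw [ptA_rhoDich_apply, ptA_rhoDich_apply, ← hc₀]
    ring
  constructor
  · rintro ⟨c, h⟩
    refine ⟨c / c₀, fun i j k l => ?_⟩
    have e := congrFun (congrFun h ((finEquivZMod d).symm i, (finEquivZMod d).symm j))
      ((finEquivZMod d).symm k, (finEquivZMod d).symm l)
    rw [hmul, Matrix.smul_apply, ptA_rhoDich_apply, ← hc₀, smul_eq_mul] at e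
    simp only [Equiv.apply_symm_apply] at e
    field_simp
    apply mul_left_cancel₀ hc
    linear_combination e
  · rintro ⟨c, h⟩
    refine ⟨c * c₀, ?_⟩
    ext p q
    rw [hmul, Matrix.smul_apply, ptA_rhoDich_apply, ← hc₀, smul_eq_mul, h]
    ring

/-- `(ρ_S^{T_A})²` is proportional to `ρ_S^{T_A}` iff for each
displacement `Δ ≠ (0,0)` the phase sum over points of `S` linked to the complement
of `S` vanishes. -/
theorem dichotomous_pt_projector_iff (d : ℕ) [NeZero d]
    (S : Finset (ZMod d × ZMod d)) (hS : S.Nonempty) :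
    (∃ c : ℂ, ptA (rhoDich d S) * ptA (rhoDich d S) = c • ptA (rhoDich d S)) ↔
    (∀ Δ : ZMod d × ZMod d, Δ ≠ 0 →
      ∑ s ∈ S.filter (fun s => s + Δ ∉ S),
        omg d ^ (((s.1.val * Δ.2.val : ℕ) : ℤ) - ((s.2.val * Δ.1.val : ℕ) : ℤ)) = 0) := by
  rw [exists_ptA_sq_eq_iff d S hS, exists_ptEntry_sq_eq_iff S hS]
  simp only [sum_phase_eq_iff]
  refine ⟨fun h Δ _ => h Δ, fun h Δ => ?_⟩
  by_cases hΔ : Δ = 0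
  · rw [Finset.filter_false_of_mem (fun s hs => by simpa [hΔ] using hs), Finset.sum_empty]
  · exact h Δ hΔ

end
end

section
/- If a nonempty subset S ⊆ Z_d × Z_d is k-displacement homogeneous, then the total number of ordered pairs linking S to its complement satisfies |S|·(d² − |S|) = (d² − 1)·k; equivalently, (k − |S|)·d² − k + |S|² = 0. -/
open Matrix Complex Finset
open scoped Kronecker ComplexOrder

noncomputable section

/-- Double counting of the ordered pairs linking a finite subset of a group to its complement. -/
theorem Finset.sum_card_filter_add_notMem {G : Type*} [AddGroup G] [Fintype G] [DecidableEq G]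
    (S : Finset G) :
    ∑ g : G, (S.filter (fun s => s + g ∉ S)).card = S.card * (Fintype.card G - S.card) := by
  simp_rw [Finset.card_filter]
  rw [Finset.sum_comm, ← smul_eq_mul, ← Finset.sum_const]
  refine Finset.sum_congr rfl fun s _ => ?_
  refine (Equiv.sum_comp (Equiv.addLeft s) fun t => if t ∉ S then 1 else 0).trans ?_
  rw [← Finset.card_filter, ← Finset.card_compl]
  congr 1
  ext t
  simp

/-- If every nonzero translation moves exactly `k` elements of `S` out of `S`, then
`|S| (|G| - |S|) = (|G| - 1) k`. -/
theorem Finset.card_mul_card_sub_of_homogeneous {G : Type*} [AddGroup G] [Fintype G]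
    [DecidableEq G] (S : Finset G) (k : ℕ)
    (h : ∀ g : G, g ≠ 0 → (S.filter (fun s => s + g ∉ S)).card = k) :
    S.card * (Fintype.card G - S.card) = (Fintype.card G - 1) * k := by
  rw [← S.sum_card_filter_add_notMem, ← Finset.add_sum_erase _ _ (Finset.mem_univ 0),
    Finset.sum_congr rfl fun g hg => h g (Finset.ne_of_mem_erase hg), Finset.sum_const,
    Finset.card_erase_of_mem (Finset.mem_univ _), Finset.card_univ, smul_eq_mul]
  simp +contextual

/-- The counting argument for `k`-displacement homogeneous sets yields
`|S|·(d² - |S|) = (d² - 1)·k`, equivalently `(k - |S|)·d² - k + |S|² = 0`. -/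
theorem homogeneous_diophantine (d : ℕ) [NeZero d]
    (S : Finset (ZMod d × ZMod d)) (hS : S.Nonempty) (k : ℕ)
    (hhom : ∀ Δ : ZMod d × ZMod d, Δ ≠ 0 →
      (S.filter (fun s => s + Δ ∉ S)).card = k) :
    S.card * (d ^ 2 - S.card) = (d ^ 2 - 1) * k ∧
    ((k : ℤ) - (S.card : ℤ)) * (d : ℤ) ^ 2 - (k : ℤ) + (S.card : ℤ) ^ 2 = 0 := by
  have hcard : Fintype.card (ZMod d × ZMod d) = d ^ 2 := by
    rw [Fintype.card_prod, ZMod.card, sq]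
  have hle : S.card ≤ d ^ 2 := hcard ▸ S.card_le_univ
  have hpos : 1 ≤ d ^ 2 := hS.card_pos.trans_le hle
  have hmain : S.card * (d ^ 2 - S.card) = (d ^ 2 - 1) * k :=
    hcard ▸ S.card_mul_card_sub_of_homogeneous k hhom
  refine ⟨hmain, ?_⟩
  zify [hle, hpos] at hmain
  linear_combination -hmain

end
end

section
/- SSC entanglement witnesses: Let {B_i^A}_{i=0}^{d_A²−1} and {B_j^B}_{j=0}^{d_B²−1} be operator bases with B_0^S = 1 and Tr((B_i^S)† B_j^S) = d_S δ_{ij} for S ∈ {A,B}, let x, y ≥ 0, set R(x,y) = √(d_A − 1 + x²)·√(d_B − 1 + y²), and let U be a d_A² × d_B² complex matrix satisfying U U† = 1. Define W = (1/2) Σ_{i,j} ( w_{ij} B_i^A ⊗ B_j^B + w_{ij}* (B_i^A)† ⊗ (B_j^B)† ), where w_{00} = x y U_{00} + R(x,y), w_{i0} = y U_{i0} for i > 0, w_{0j} = x U_{0j} for j > 0, and w_{ij} = U_{ij} for i, j > 0. Then W is Hermitian and Tr(W σ) ≥ 0 for every separable density matrix σ on C^{d_A} ⊗ C^{d_B}.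 -/
open Matrix Complex Finset
open scoped Kronecker ComplexOrder

noncomputable section

instance (n : ℕ) [NeZero n] : NeZero (n ^ 2) := ⟨pow_ne_zero _ (NeZero.ne n)⟩

/-- A positive semidefinite matrix has Hilbert–Schmidt norm at most its trace. -/
lemma sum_norm_sq_le_trace_sq {n : Type*} [Fintype n] {a : Matrix n n ℂ}
    (ha : a.PosSemidef) : ∑ i, ∑ j, ‖a i j‖ ^ 2 ≤ a.trace.re ^ 2 := by
  have hminor (i j : n) : ‖a i j‖ ^ 2 ≤ (a i i).re * (a j j).re := by
    have hdet := (ha.submatrix ![i, j]).det_nonneg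
    have hdiag (k : n) : (a k k).im = 0 := by
      have := congrArg Complex.im (ha.isHermitian.apply k k)
      simp only [RCLike.star_def, Complex.conj_im] at this
      linarith
    have hre := (Complex.le_def.mp hdet).1
    rw [det_fin_two] at hre
    simp only [submatrix_apply, cons_val_zero, cons_val_one, ← ha.isHermitian.apply j i,
      RCLike.star_def, Complex.mul_conj, Complex.normSq_eq_norm_sq] at hre
    simp only [Complex.sub_re, Complex.mul_re, hdiag, Complex.zero_re, Complex.ofReal_re] at hre
    linarith
  calc ∑ i, ∑ j, ‖a i j‖ ^ 2 ≤ ∑ i, ∑ j, (a i i).re * (a j j).re :=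
        sum_le_sum fun i _ => sum_le_sum fun j _ => hminor i j
    _ = a.trace.re ^ 2 := by
        simp only [trace, diag_apply, Complex.re_sum, sq, sum_mul_sum]

/-- For Hermitian `a`, `Tr(Bᴴ a)` is the conjugate of `Tr(B a)`. -/
lemma trace_conjTranspose_mul_of_isHermitian {n : Type*} [Fintype n] {a : Matrix n n ℂ}
    (ha : a.IsHermitian) (B : Matrix n n ℂ) :
    (Bᴴ * a).trace = (starRingEnd ℂ) (B * a).trace := by
  rw [starRingEnd_apply, ← trace_conjTranspose, conjTranspose_mul, ha.eq, trace_mul_comm]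

/-- Bessel's inequality for the Hilbert–Schmidt inner product. -/
lemma sum_norm_sq_trace_le {n ι : Type*} [Fintype n] [Fintype ι] [DecidableEq ι] {d : ℝ}
    (hd : 0 < d) {B : ι → Matrix n n ℂ}
    (hB : ∀ i j, ((B i)ᴴ * B j).trace = if i = j then (d : ℂ) else 0) (a : Matrix n n ℂ) :
    ∑ i, ‖((B i)ᴴ * a).trace‖ ^ 2 ≤ d * ∑ i, ∑ j, ‖a i j‖ ^ 2 := by
  let vec (M : Matrix n n ℂ) : EuclideanSpace ℂ (n × n) := WithLp.toLp 2 fun p => M p.1 p.2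
  have hinner (M N : Matrix n n ℂ) : inner ℂ (vec M) (vec N) = (Mᴴ * N).trace := by
    simp only [vec, PiLp.inner_apply, RCLike.inner_apply, trace, diag_apply, mul_apply,
      conjTranspose_apply, Fintype.sum_prod_type, RCLike.star_def]
    rw [sum_comm]
    simp only [mul_comm]
  have hs : (Real.sqrt d : ℂ) ^ 2 = d := by exact_mod_cast Real.sq_sqrt hd.le
  have hs0 : (Real.sqrt d : ℂ) ≠ 0 := by exact_mod_cast (Real.sqrt_pos.mpr hd).ne'
  have horth : Orthonormal ℂ fun i => (Real.sqrt d : ℂ)⁻¹ • vec (B i) := by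
    rw [orthonormal_iff_ite]
    intro i j
    rw [inner_smul_left, inner_smul_right, hinner, hB]
    split_ifs
    · rw [map_inv₀, Complex.conj_ofReal, ← hs]
      field_simp
    · simp
  have h := horth.sum_inner_products_le (vec a) (s := univ)
  have hterm (i : ι) : ‖inner ℂ ((Real.sqrt d : ℂ)⁻¹ • vec (B i)) (vec a)‖ ^ 2
      = d⁻¹ * ‖((B i)ᴴ * a).trace‖ ^ 2 := by
    rw [inner_smul_left, hinner, norm_mul, mul_pow, map_inv₀, Complex.conj_ofReal, norm_inv,
      Complex.norm_real, inv_pow, Real.norm_eq_abs, sq_abs, Real.sq_sqrt hd.le]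
  simp only [hterm, ← mul_sum] at h
  rw [EuclideanSpace.norm_sq_eq, Fintype.sum_prod_type, inv_mul_le_iff₀ hd] at h
  exact h

/-- The Bloch coefficients of a density matrix, with the coefficient of the identity replaced
by `x`, have squared norm at most `d - 1 + x ^ 2`. -/
lemma sum_norm_sq_bloch_le {n ι : Type*} [Fintype n] [DecidableEq n] [Fintype ι] [DecidableEq ι]
    {d : ℝ} (hd : 0 < d) {B : ι → Matrix n n ℂ} {i₀ : ι} (hB0 : B i₀ = 1)
    (hB : ∀ i j, ((B i)ᴴ * B j).trace = if i = j then (d : ℂ) else 0) {a : Matrix n n ℂ}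
    (ha : a.PosSemidef) (htr : a.trace = 1) (x : ℝ) :
    ∑ i, ‖if i = i₀ then (x : ℂ) else (B i * a).trace‖ ^ 2 ≤ d - 1 + x ^ 2 := by
  have hbessel := sum_norm_sq_trace_le hd hB a
  simp only [trace_conjTranspose_mul_of_isHermitian ha.isHermitian, RCLike.norm_conj] at hbessel
  have hnorm := sum_norm_sq_le_trace_sq ha
  rw [htr, Complex.one_re, one_pow] at hnorm
  have hle : ∑ i, ‖(B i * a).trace‖ ^ 2 ≤ d :=
    hbessel.trans (mul_le_of_le_one_right hd.le hnorm)
  rw [← add_sum_erase _ _ (mem_univ i₀)] at hle ⊢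
  rw [hB0, one_mul, htr, norm_one, one_pow] at hle
  rw [if_pos rfl, Complex.norm_real, Real.norm_eq_abs, sq_abs, sum_congr rfl fun i hi => by
    rw [if_neg (ne_of_mem_erase hi)]]
  linarith

lemma ofReal_sum_norm_sq {n : Type*} [Fintype n] (v : n → ℂ) :
    ((∑ i, ‖v i‖ ^ 2 : ℝ) : ℂ) = v ⬝ᵥ star v := by
  simp [dotProduct, Complex.mul_conj, Complex.normSq_eq_norm_sq]

/-- A matrix with orthonormal rows defines a bilinear form of norm at most one. -/
lemma norm_sum_mul_le_of_mul_conjTranspose_eq_one {m n : Type*} [Fintype m] [DecidableEq m]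
    [Fintype n] {U : Matrix m n ℂ} (hU : U * Uᴴ = 1) (r : m → ℂ) (s : n → ℂ) :
    ‖∑ i, ∑ j, U i j * r i * s j‖ ≤
      Real.sqrt (∑ i, ‖r i‖ ^ 2) * Real.sqrt (∑ j, ‖s j‖ ^ 2) := by
  have hiso : ∑ j, ‖(r ᵥ* U) j‖ ^ 2 = ∑ i, ‖r i‖ ^ 2 := by
    have h : (r ᵥ* U) ⬝ᵥ star (r ᵥ* U) = r ⬝ᵥ star r := by
      rw [star_vecMul, ← dotProduct_mulVec, mulVec_mulVec, hU, one_mulVec]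
    rw [← Complex.ofReal_inj, ofReal_sum_norm_sq, ofReal_sum_norm_sq, h]
  calc ‖∑ i, ∑ j, U i j * r i * s j‖ = ‖∑ j, (r ᵥ* U) j * s j‖ := by
        rw [sum_comm]
        simp only [vecMul, dotProduct, sum_mul, mul_comm (r _)]
    _ ≤ ∑ j, ‖(r ᵥ* U) j‖ * ‖s j‖ := by
        simpa only [norm_mul] using norm_sum_le univ fun j => (r ᵥ* U) j * s j
    _ ≤ _ := by
        rw [← hiso]
        exact Real.sum_mul_le_sqrt_mul_sqrt _ _ _

/-- The SSC entanglement witnesses are Hermitian and have nonnegative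
expectation value on every separable state. -/
theorem ssc_witness (dA dB : ℕ) [NeZero dA] [NeZero dB]
    (BA : Fin (dA ^ 2) → Matrix (Fin dA) (Fin dA) ℂ)
    (BB : Fin (dB ^ 2) → Matrix (Fin dB) (Fin dB) ℂ)
    (hBA0 : BA 0 = 1) (hBB0 : BB 0 = 1)
    (hBA : ∀ i j, ((BA i)ᴴ * BA j).trace = if i = j then (dA : ℂ) else 0)
    (hBB : ∀ i j, ((BB i)ᴴ * BB j).trace = if i = j then (dB : ℂ) else 0)
    (x y : ℝ) (hx : 0 ≤ x) (hy : 0 ≤ y)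
    (U : Matrix (Fin (dA ^ 2)) (Fin (dB ^ 2)) ℂ) (hU : U * Uᴴ = 1)
    (w : Fin (dA ^ 2) → Fin (dB ^ 2) → ℂ)
    (hw : ∀ i j, w i j =
      if i = 0 ∧ j = 0 then
        (x : ℂ) * (y : ℂ) * U 0 0 +
          ((Real.sqrt ((dA : ℝ) - 1 + x ^ 2) * Real.sqrt ((dB : ℝ) - 1 + y ^ 2) : ℝ) : ℂ)
      else if j = 0 then (y : ℂ) * U i 0
      else if i = 0 then (x : ℂ) * U 0 j
      else U i j)
    (W : Matrix (Fin dA × Fin dB) (Fin dA × Fin dB) ℂ)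
    (hW : W = (1 / 2 : ℂ) • ∑ i : Fin (dA ^ 2), ∑ j : Fin (dB ^ 2),
      (w i j • (BA i ⊗ₖ BB j) + (starRingEnd ℂ) (w i j) • ((BA i)ᴴ ⊗ₖ (BB j)ᴴ))) :
    W.IsHermitian ∧ ∀ σ : Matrix (Fin dA × Fin dB) (Fin dA × Fin dB) ℂ,
      IsSepState σ → 0 ≤ (W * σ).trace := by
  simp only [← Complex.ofReal_natCast] at hBA hBB
  have hdA : (0 : ℝ) < dA := by exact_mod_cast NeZero.pos dA
  have hdB : (0 : ℝ) < dB := by exact_mod_cast NeZero.pos dB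
  constructor
  · rw [hW, IsHermitian, conjTranspose_smul, conjTranspose_sum]
    congr 1
    · simp
    refine sum_congr rfl fun i _ => ?_
    rw [conjTranspose_sum]
    refine sum_congr rfl fun j _ => ?_
    simp only [conjTranspose_add, conjTranspose_smul, conjTranspose_kronecker,
      conjTranspose_conjTranspose, RCLike.star_def, Complex.conj_conj]
    exact add_comm _ _
  rintro σ ⟨n, q, a, b, hq, -, ha, hb, rfl⟩
  simp only [Matrix.mul_sum, trace_sum, Matrix.mul_smul, trace_smul, smul_eq_mul]
  refine sum_nonneg fun k _ => mul_nonneg (by exact_mod_cast hq k) ?_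
  obtain ⟨hapos, hatr⟩ := ha k
  obtain ⟨hbpos, hbtr⟩ := hb k
  set R : ℝ := Real.sqrt ((dA : ℝ) - 1 + x ^ 2) * Real.sqrt ((dB : ℝ) - 1 + y ^ 2)
  let r (i : Fin (dA ^ 2)) : ℂ := if i = 0 then (x : ℂ) else (BA i * a k).trace
  let s (j : Fin (dB ^ 2)) : ℂ := if j = 0 then (y : ℂ) else (BB j * b k).trace
  have htrace : (W * (a k ⊗ₖ b k)).trace =
      ((∑ i, ∑ j, w i j * (BA i * a k).trace * (BB j * b k).trace).re : ℂ) := by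
    rw [Complex.re_eq_add_conj, hW]
    simp only [Matrix.smul_mul, Matrix.sum_mul, Matrix.add_mul, trace_smul, trace_sum, trace_add,
      ← mul_kronecker_mul, trace_kronecker, smul_eq_mul, map_sum, map_mul, sum_add_distrib,
      trace_conjTranspose_mul_of_isHermitian hapos.isHermitian,
      trace_conjTranspose_mul_of_isHermitian hbpos.isHermitian, mul_assoc]
    ring
  have hsum : ∑ i, ∑ j, w i j * (BA i * a k).trace * (BB j * b k).trace =
      R + ∑ i, ∑ j, U i j * r i * s j := by
    have hterm (i : Fin (dA ^ 2)) (j : Fin (dB ^ 2)) :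
        w i j * (BA i * a k).trace * (BB j * b k).trace =
          (if i = 0 then if j = 0 then (R : ℂ) else 0 else 0) + U i j * r i * s j := by
      rw [hw]
      by_cases hi : i = 0 <;> by_cases hj : j = 0 <;>
        simp only [hi, hj, r, s, hBA0, hBB0, one_mul, hatr, hbtr, and_self, and_true, and_false,
          if_true, if_false] <;> ring
    simp [hterm, sum_add_distrib]
  have hbound : ‖∑ i, ∑ j, U i j * r i * s j‖ ≤ R :=
    (norm_sum_mul_le_of_mul_conjTranspose_eq_one hU r s).trans <|
      mul_le_mul
        (Real.sqrt_le_sqrt <| sum_norm_sq_bloch_le hdA hBA0 hBA hapos hatr x)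
        (Real.sqrt_le_sqrt <| sum_norm_sq_bloch_le hdB hBB0 hBB hbpos hbtr y)
        (Real.sqrt_nonneg _) (Real.sqrt_nonneg _)
  rw [htrace, hsum, Complex.zero_le_real, Complex.add_re, Complex.ofReal_re]
  linarith [neg_le_of_abs_le ((Complex.abs_re_le_norm _).trans hbound)]

end
end
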